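/- For the symmetric random walk started from ⌊αN⌋ with 0 < α < 1, the expected scaled range converges to the entropy of the exit distribution ⟨1−α, α⟩: lim_{N→∞} E_{⌊αN⌋}[R_N/N] = −(1−α)log(1−α) − α log α. -/

import Mathlib

open Filter Topology

/-- Position of the nearest-neighbor walk after the steps `w` (`true` = one step right,
`false` = one step left), started from `x`. -/
def walkPos (x : ℤ) (w : List Bool) : ℤ :=
  x + (w.count true : ℤ) - (w.count false : ℤ)

/-- `w` is the step sequence of a trajectory on `{0, 1, …, N}` started at `x` and run
exactly until the exit time `τ_N = T_0 ∧ T_N`: all positions strictly before the last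
step lie strictly inside `(0, N)`, and the final position is `0` or `N`. -/
def IsExitPath (N : ℕ) (x : ℤ) (w : List Bool) : Prop :=
  (∀ k < w.length, 0 < walkPos x (w.take k) ∧ walkPos x (w.take k) < (N : ℤ)) ∧
    (walkPos x w = 0 ∨ walkPos x w = (N : ℤ))

/-- Probability weight of the step sequence `w` when each step goes right with
probability `p` and left with probability `1 - p`, independently. -/
noncomputable def wt (p : ℝ) (w : List Bool) : ℝ :=
  p ^ w.count true * (1 - p) ^ w.count false

/-- `prob N p x S` is the probability, for the walk on `{0, …, N}` with right-step
probability `p` started at `x` and stopped at the exit time `τ_N`, that its stopped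
trajectory (recorded as the step sequence up to time `τ_N`) satisfies `S`. -/
noncomputable def prob (N : ℕ) (p : ℝ) (x : ℤ) (S : List Bool → Prop) : ℝ :=
  ∑' w : List Bool, Set.indicator {w | IsExitPath N x w ∧ S w} (wt p) w

/-- Expectation of `f` of the stopped trajectory for the walk started at `x`. -/
noncomputable def expect (N : ℕ) (p : ℝ) (x : ℤ) (f : List Bool → ℝ) : ℝ :=
  ∑' w : List Bool, Set.indicator {w | IsExitPath N x w} (fun w => wt p w * f w) w

/-- Probability for the walk whose starting point is uniformly distributed on
`{0, 1, …, N}`; the event `S` may depend on the starting point. -/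
noncomputable def probUniform (N : ℕ) (p : ℝ) (S : ℤ → List Bool → Prop) : ℝ :=
  (∑ x ∈ Finset.range (N + 1), prob N p (x : ℤ) (S (x : ℤ))) / (N + 1)

/-- The set of sites visited by the stopped walk up to time `τ_N` (time `0` included). -/
def rangeSet (x : ℤ) (w : List Bool) : Finset ℤ :=
  (Finset.range (w.length + 1)).image fun k => walkPos x (w.take k)

/-- The range `R_N`: the number of distinct sites visited up to the exit time. -/
def rangeCount (x : ℤ) (w : List Bool) : ℕ := (rangeSet x w).card

/-- The local time `G(y) = Σ_{k=0}^{τ_N} 1_{X_k = y}` of the stopped trajectory `w`. -/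
def localTime (x y : ℤ) (w : List Bool) : ℕ :=
  ((Finset.range (w.length + 1)).filter fun k => walkPos x (w.take k) = y).card

/-- The event `T_y < τ_N`: the walk started at `x` visits `y` at some time
`k ≥ 1` strictly before the end of the stopped trajectory `w`. -/
def hitsBefore (x y : ℤ) (w : List Bool) : Prop :=
  ∃ k, 1 ≤ k ∧ k < w.length ∧ walkPos x (w.take k) = y

open scoped ENNReal

noncomputable def rwA (f : List Bool → ℝ≥0∞) : ℝ≥0∞ := ∑' w, (2⁻¹ : ℝ≥0∞) ^ w.length * f w

def rwEquiv : Unit ⊕ (List Bool ⊕ List Bool) ≃ List Bool where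
  toFun s := match s with
    | Sum.inl _ => []
    | Sum.inr (Sum.inl w) => true :: w
    | Sum.inr (Sum.inr w) => false :: w
  invFun w := match w with
    | [] => Sum.inl ()
    | true :: w => Sum.inr (Sum.inl w)
    | false :: w => Sum.inr (Sum.inr w)
  left_inv := by rintro (_ | _ | _) <;> rfl
  right_inv := by rintro (_ | ⟨_ | _, _⟩) <;> rfl

lemma rwA_cons (f : List Bool → ℝ≥0∞) :
    rwA f = f [] + 2⁻¹ * rwA (fun w => f (true :: w)) + 2⁻¹ * rwA (fun w => f (false :: w)) := by
  unfold rwA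
  rw [← rwEquiv.tsum_eq, Summable.tsum_sum ENNReal.summable ENNReal.summable,
    Summable.tsum_sum ENNReal.summable ENNReal.summable, ← ENNReal.tsum_mul_left, ← ENNReal.tsum_mul_left]
  simp [rwEquiv, pow_succ', mul_assoc, add_assoc]

lemma walkPos_true (x : ℤ) (w : List Bool) : walkPos x (true :: w) = walkPos (x + 1) w := by
  simp [walkPos]; ring

lemma walkPos_false (x : ℤ) (w : List Bool) : walkPos x (false :: w) = walkPos (x - 1) w := by
  simp [walkPos]; ring

lemma walkPos_nil (x : ℤ) : walkPos x [] = x := by simp [walkPos]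

lemma exit_nil (N : ℕ) (x : ℤ) : IsExitPath N x [] ↔ x = 0 ∨ x = N := by
  simp [IsExitPath, walkPos_nil]

lemma exit_cons (N : ℕ) (x x' : ℤ) (b : Bool) (hb : ∀ w, walkPos x (b :: w) = walkPos x' w)
    (w : List Bool) :
    IsExitPath N x (b :: w) ↔ (0 < x ∧ x < N) ∧ IsExitPath N x' w := by
  unfold IsExitPath
  rw [hb, ← and_assoc]
  refine and_congr_left fun _ => ?_
  constructor
  · intro h
    refine ⟨by simpa [walkPos_nil] using h 0 (by simp), fun k hk => ?_⟩
    simpa [hb] using h (k + 1) (by simpa using hk)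
  · rintro ⟨h1, h2⟩ k hk
    cases k with
    | zero => simpa [walkPos_nil] using h1
    | succ k => simpa [hb] using h2 k (by simpa using hk)

lemma mem_range_cons (x x' y : ℤ) (b : Bool) (hb : ∀ w, walkPos x (b :: w) = walkPos x' w)
    (w : List Bool) : y ∈ rangeSet x (b :: w) ↔ y = x ∨ y ∈ rangeSet x' w := by
  simp only [rangeSet, Finset.mem_image, Finset.mem_range]
  constructor
  · rintro ⟨k, hk, rfl⟩
    cases k with
    | zero => left; simp [walkPos_nil]
    | succ k => right; exact ⟨k, by simpa using hk, by simp [hb]⟩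
  · rintro (rfl | ⟨k, hk, rfl⟩)
    · exact ⟨0, by simp, by simp [walkPos_nil]⟩
    · exact ⟨k + 1, by simpa using hk, by simp [hb]⟩

lemma mem_range_nil (x y : ℤ) : y ∈ rangeSet x [] ↔ y = x := by
  simp [rangeSet, walkPos_nil, eq_comm]

lemma mem_range_self (x : ℤ) (w : List Bool) : x ∈ rangeSet x w := by
  simp only [rangeSet, Finset.mem_image, Finset.mem_range]
  exact ⟨0, by simp, by simp [walkPos_nil]⟩

lemma range_subset (N : ℕ) (x : ℤ) (w : List Bool) (h : IsExitPath N x w) (y : ℤ)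
    (hy : y ∈ rangeSet x w) : 0 ≤ y ∧ y ≤ N := by
  simp only [rangeSet, Finset.mem_image, Finset.mem_range] at hy
  obtain ⟨k, hk, rfl⟩ := hy
  rcases Nat.lt_succ_iff_lt_or_eq.1 hk with h1 | rfl
  · have := h.1 k h1; omega
  · have := h.2; simp only [List.take_length]; omega

open Classical in
/-- mass of the exit paths satisfying a predicate -/
noncomputable def rwM (N : ℕ) (x : ℤ) (S : List Bool → Prop) : ℝ≥0∞ :=
  rwA fun w => if IsExitPath N x w ∧ S w then 1 else 0

lemma rwA_zero : rwA (fun _ => 0) = 0 := by simp [rwA]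

lemma rwA_mono {f g : List Bool → ℝ≥0∞} (h : ∀ w, f w ≤ g w) : rwA f ≤ rwA g :=
  ENNReal.tsum_le_tsum fun w => by gcongr; exact h w

lemma rwM_bdry (N : ℕ) (x : ℤ) (S : List Bool → Prop) (hx : x = 0 ∨ x = N) (h : S []) :
    rwM N x S = 1 := by
  have h' : ¬ (0 < x ∧ x < N) := by omega
  unfold rwM
  rw [rwA_cons]
  simp [exit_nil, exit_cons N x _ true (walkPos_true x), exit_cons N x _ false (walkPos_false x),
    h', rwA_zero, h, hx]

lemma rwM_bdry' (N : ℕ) (x : ℤ) (S : List Bool → Prop) (hx : x = 0 ∨ x = N) (h : ¬ S []) :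
    rwM N x S = 0 := by
  have h' : ¬ (0 < x ∧ x < N) := by omega
  unfold rwM
  rw [rwA_cons]
  simp [exit_nil, exit_cons N x _ true (walkPos_true x), exit_cons N x _ false (walkPos_false x),
    h', rwA_zero, h]

lemma rwM_out (N : ℕ) (x : ℤ) (S : List Bool → Prop) (hx : x < 0 ∨ N < x) :
    rwM N x S = 0 := by
  have h' : ¬ (0 < x ∧ x < N) := by omega
  have h'' : ¬ (x = 0 ∨ x = N) := by omega
  unfold rwM
  rw [rwA_cons]
  simp [exit_nil, exit_cons N x _ true (walkPos_true x), exit_cons N x _ false (walkPos_false x),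
    h', rwA_zero, h'']

lemma rwM_int (N : ℕ) (x : ℤ) (S : List Bool → Prop) (hx : 0 < x ∧ x < N) :
    rwM N x S = 2⁻¹ * rwM N (x + 1) (fun w => S (true :: w))
      + 2⁻¹ * rwM N (x - 1) (fun w => S (false :: w)) := by
  have h'' : ¬ (x = 0 ∨ x = N) := by omega
  unfold rwM
  rw [rwA_cons]
  have e1 : ∀ w, IsExitPath N x (true :: w) = IsExitPath N (x + 1) w := fun w => propext <| by
    rw [exit_cons N x _ true (walkPos_true x)]; exact and_iff_right hx
  have e2 : ∀ w, IsExitPath N x (false :: w) = IsExitPath N (x - 1) w := fun w => propext <| by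
    rw [exit_cons N x _ false (walkPos_false x)]; exact and_iff_right hx
  rw [if_neg (by rw [exit_nil]; tauto), zero_add]
  classical
  congr 3 <;> funext w
  · apply if_congr (by rw [e1]) rfl rfl
  · apply if_congr (by rw [e2]) rfl rfl

lemma rwM_len (N : ℕ) (n : ℕ) : ∀ x : ℤ, rwM N x (fun w => w.length < n) ≤ 1 := by
  induction n with
  | zero => intro x; simp [rwM, rwA_zero]
  | succ n ih =>
    intro x
    by_cases hx : x < 0 ∨ N < x
    · rw [rwM_out N x _ hx]; simp
    by_cases hx' : x = 0 ∨ x = N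
    · rw [rwM_bdry N x _ hx' (by simp)]
    rw [rwM_int N x _ (by omega)]
    simp only [List.length_cons, Nat.add_lt_add_iff_right]
    calc _ ≤ (2⁻¹ : ℝ≥0∞) * 1 + 2⁻¹ * 1 := by gcongr <;> apply ih
      _ = 1 := by simp [ENNReal.inv_two_add_inv_two]

lemma rwM_le_one (N : ℕ) (x : ℤ) (S : List Bool → Prop) : rwM N x S ≤ 1 := by
  classical
  unfold rwM rwA
  rw [ENNReal.tsum_eq_iSup_sum]
  refine iSup_le fun s => ?_
  refine le_trans ?_ (rwM_len N (s.sup List.length + 1) x)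
  unfold rwM rwA
  refine le_trans ?_ (ENNReal.sum_le_tsum s)
  refine Finset.sum_le_sum fun w hw => ?_
  have : w.length < s.sup List.length + 1 := Nat.lt_succ_of_le (Finset.le_sup hw)
  gcongr
  beta_reduce
  split_ifs <;> simp_all

lemma linear_of_harm (g : ℤ → ℝ) (a : ℤ) (n : ℕ)
    (h : ∀ x, a < x → x < a + n → g x = (g (x + 1) + g (x - 1)) / 2) :
    ∀ k : ℕ, k ≤ n → (n : ℝ) * g (a + k) = n * g a + k * (g (a + n) - g a) := by
  have key : ∀ k : ℕ, (k ≤ n → g (a + k) = g a + k * (g (a + 1) - g a)) ∧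
      (k + 1 ≤ n → g (a + (k + 1 : ℕ)) = g a + ((k + 1 : ℕ) : ℝ) * (g (a + 1) - g a)) := by
    intro k
    induction k with
    | zero => simp
    | succ k ih =>
      refine ⟨ih.2, fun hk => ?_⟩
      have h1 := ih.1 (by omega)
      have h2 := ih.2 (by omega)
      have h3 := h (a + (k + 1 : ℕ)) (by omega) (by omega)
      rw [show a + ((k + 1 : ℕ) : ℤ) - 1 = a + k by push_cast; ring,
        show a + ((k + 1 : ℕ) : ℤ) + 1 = a + (k + 1 + 1 : ℕ) by push_cast; ring] at h3
      push_cast at *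
      linarith
  intro k hk
  rw [(key k).1 hk, (key n).1 le_rfl]
  ring

lemma rwM_true (N : ℕ) (k : ℕ) (hk : k ≤ N) (hN : 0 < N) : rwM N k (fun _ => True) = 1 := by
  have := linear_of_harm (fun x => (rwM N x (fun _ => True)).toReal) 0 N ?_ k hk
  · simp only [zero_add] at this
    rw [rwM_bdry N 0 _ (by simp) trivial, rwM_bdry N N _ (by simp) trivial] at this
    have hN' : (N : ℝ) ≠ 0 := by positivity
    have h2 : (rwM N k (fun _ => True)).toReal = 1 := by
      apply mul_left_cancel₀ hN'; simpa using this
    exact (ENNReal.toReal_eq_one_iff _).1 h2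
  · intro x h1 h2
    have a1 := (rwM_le_one N (x+1) (fun _ => True)).trans_lt ENNReal.one_lt_top
    have a2 := (rwM_le_one N (x-1) (fun _ => True)).trans_lt ENNReal.one_lt_top
    rw [rwM_int N x _ (by omega), ENNReal.toReal_add (by finiteness) (by finiteness)]
    simp; ring

/-- hitting probability -/
noncomputable def hitP (N : ℕ) (y x : ℤ) : ℝ := (rwM N x (fun w => y ∈ rangeSet x w)).toReal

lemma hitP_self (N y : ℕ) (hy : y ≤ N) (hN : 0 < N) : hitP N y y = 1 := by
  unfold hitP
  simp [mem_range_self, rwM_true N y hy hN]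

lemma hitP_harm (N : ℕ) (y x : ℤ) (hx : 0 < x ∧ x < N) (hy : y ≠ x) :
    hitP N y x = (hitP N y (x + 1) + hitP N y (x - 1)) / 2 := by
  unfold hitP
  have a1 := (rwM_le_one N (x+1) (fun w => y ∈ rangeSet (x + 1) w)).trans_lt ENNReal.one_lt_top
  have a2 := (rwM_le_one N (x-1) (fun w => y ∈ rangeSet (x - 1) w)).trans_lt ENNReal.one_lt_top
  rw [rwM_int N x _ hx]
  simp only [mem_range_cons x _ y true (walkPos_true x), mem_range_cons x _ y false (walkPos_false x),
    hy, false_or]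
  rw [ENNReal.toReal_add (by finiteness) (by finiteness)]
  simp; ring

lemma hitP_bdry (N : ℕ) (y x : ℤ) (hx : x = 0 ∨ x = N) (hy : y ≠ x) : hitP N y x = 0 := by
  unfold hitP
  rw [rwM_bdry' N x _ hx (by simpa [mem_range_nil] using hy)]
  simp

lemma hitP_right (N y x : ℕ) (hx : x < y) (hy : y ≤ N) : hitP N y x = x / y := by
  have := linear_of_harm (hitP N y) 0 y
    (fun z h1 h2 => hitP_harm N y z (by omega) (by omega)) x hx.le
  simp only [zero_add] at this
  rw [hitP_self N y hy (by omega), hitP_bdry N y 0 (by simp) (by omega)] at this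
  have hy' : (y : ℝ) ≠ 0 := by
    have : y ≠ 0 := by omega
    exact_mod_cast this
  field_simp
  linarith

lemma hitP_left (N y x : ℕ) (hx : y < x) (hxN : x ≤ N) :
    hitP N y x = ((N : ℝ) - x) / (N - y) := by
  obtain ⟨n, rfl⟩ := Nat.exists_eq_add_of_lt (hx.trans_le hxN)
  obtain ⟨k, rfl⟩ := Nat.exists_eq_add_of_lt hx
  have := linear_of_harm (hitP (y + n + 1) y) y (n + 1)
    (fun z h1 h2 => hitP_harm _ y z (by omega) (by omega)) (k + 1) (by omega)
  rw [hitP_self _ y (by omega) (by omega),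
    hitP_bdry (y + n + 1) y (y + (n + 1 : ℕ)) (by right; push_cast; ring) (by omega)] at this
  have hn : (n : ℝ) + 1 ≠ 0 := by positivity
  have e : ((y + k + 1 : ℕ) : ℤ) = (y : ℤ) + (k + 1 : ℕ) := by push_cast; ring
  rw [e, eq_div_iff (by push_cast; ring_nf; rw [add_comm]; exact hn)]
  push_cast at *
  linarith

lemma wt_half (w : List Bool) : wt (1/2) w = (2⁻¹ : ℝ) ^ w.length := by
  unfold wt
  rw [show (1 : ℝ) - 1/2 = 1/2 by norm_num, ← pow_add, List.count_true_add_count_false]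
  norm_num

lemma expect_eq (N : ℕ) (x : ℤ) (c : ℝ) :
    expect N (1/2) x (fun w => (rangeCount x w : ℝ) / c) =
      (∑ y ∈ Finset.range (N + 1), hitP N y x) / c := by
  classical
  have h1 : ∀ w, IsExitPath N x w → (rangeCount x w : ℝ≥0∞) =
      ∑ y ∈ Finset.range (N + 1), if (y : ℤ) ∈ rangeSet x w then 1 else 0 := by
    intro w hw
    rw [Finset.sum_boole]
    congr 1
    unfold rangeCount
    symm
    apply Finset.card_bij (fun (y : ℕ) _ => (y : ℤ))
    · intro a ha; exact (Finset.mem_filter.1 ha).2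
    · intro a _ b _ h; exact_mod_cast h
    · intro b hb
      have := range_subset N x w hw b hb
      refine ⟨b.toNat, ?_, by omega⟩
      rw [Finset.mem_filter, Finset.mem_range, Int.toNat_of_nonneg this.1]
      exact ⟨by omega, hb⟩
  have h2 : ∑ y ∈ Finset.range (N + 1), hitP N y x =
      (rwA fun w => if IsExitPath N x w then (rangeCount x w : ℝ≥0∞) else 0).toReal := by
    unfold hitP
    rw [← ENNReal.toReal_sum (fun y _ =>
      ((rwM_le_one N x _).trans_lt ENNReal.one_lt_top).ne)]
    congr 1
    unfold rwM rwA
    rw [← Summable.tsum_finsetSum (fun _ _ => ENNReal.summable)]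
    congr 1
    ext w
    rw [← Finset.mul_sum]
    congr 1
    by_cases hw : IsExitPath N x w
    · simp only [hw, true_and, if_true]; exact (h1 w hw).symm
    · simp [hw]
  rw [h2]
  unfold rwA expect
  rw [ENNReal.tsum_toReal_eq, ← tsum_div_const]
  · congr 1
    ext w
    by_cases hw : IsExitPath N x w
    · have := wt_half w
      rw [Set.indicator_of_mem (by exact hw), this]
      simp [hw, mul_div_assoc]
    · simp [hw]
  · intro w
    beta_reduce
    split_ifs <;> finiteness

lemma harm_sum (m k : ℕ) : ∑ i ∈ Finset.range k, (1 : ℝ) / (m + i + 1) =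
    (harmonic (m + k) : ℝ) - harmonic m := by
  induction k with
  | zero => simp
  | succ k ih =>
    rw [Finset.sum_range_succ, ih, ← add_assoc, harmonic_succ]
    push_cast
    ring

lemma hit_sum (m k : ℕ) (hm : 0 < m) :
    ∑ y ∈ Finset.range (m + k + 1), hitP (m + k) y m =
      k * ((harmonic (m + k) : ℝ) - harmonic k) + m * ((harmonic (m + k) : ℝ) - harmonic m) + 1 := by
  rw [add_assoc, Finset.sum_range_add, Finset.sum_range_succ']
  have h1 : ∑ y ∈ Finset.range m, hitP (m + k) y m =
      k * ((harmonic (m + k) : ℝ) - harmonic k) := by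
    rw [← Finset.sum_range_reflect, add_comm m k, ← harm_sum, Finset.mul_sum]
    refine Finset.sum_congr rfl fun i hi => ?_
    have hi := Finset.mem_range.1 hi
    rw [hitP_left _ _ _ (by omega) (by omega)]
    obtain ⟨j, rfl⟩ := Nat.exists_eq_add_of_lt hi
    rw [show i + j + 1 - 1 - i = j by omega]
    push_cast
    ring_nf
  have h2 : ∑ i ∈ Finset.range k, hitP (m + k) ((m + (i + 1) : ℕ) : ℤ) m =
      m * ((harmonic (m + k) : ℝ) - harmonic m) := by
    rw [← harm_sum, Finset.mul_sum]
    refine Finset.sum_congr rfl fun i hi => ?_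
    have hi := Finset.mem_range.1 hi
    rw [hitP_right _ _ _ (by omega) (by omega)]
    push_cast
    ring_nf
  rw [h1, h2, add_zero, hitP_self _ _ (by omega) (by omega)]
  ring

/-- the harmonic asymptotics along a sequence with linear growth -/
lemma harm_diff (u : ℕ → ℕ) (β : ℝ) (hβ : 0 < β)
    (hu : Tendsto (fun N : ℕ => (u N : ℝ) / N) atTop (𝓝 β)) :
    Tendsto (fun N : ℕ => ((harmonic N : ℝ) - harmonic (u N))) atTop (𝓝 (- Real.log β)) := by
  have hinf : Tendsto u atTop atTop := by
    rw [← tendsto_natCast_atTop_iff (R := ℝ)]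
    have := hu.pos_mul_atTop hβ (tendsto_natCast_atTop_atTop (R := ℝ))
    refine this.congr' ?_
    filter_upwards [eventually_gt_atTop 0] with N hN
    field_simp
  have h1 := Real.tendsto_harmonic_sub_log
  have h2 := h1.comp hinf
  have h3 := (hu.log hβ.ne')
  have := (h1.sub h2).sub h3
  rw [sub_self, zero_sub] at this
  refine this.congr' ?_
  filter_upwards [eventually_gt_atTop 0, hinf.eventually_gt_atTop 0] with N hN hN'
  rw [Real.log_div (by positivity) (by positivity)]
  simp only [Function.comp_apply]
  ring

/-- Remark 1.2: for the symmetric walk started from `⌊αN⌋`, the expected scaled range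
converges to the entropy of the exit distribution `⟨1-α, α⟩`. -/
theorem expected_range_entropy (α : ℝ) (hα0 : 0 < α) (hα1 : α < 1) :
    Tendsto (fun N : ℕ => expect N (1/2) ⌊α * (N : ℝ)⌋
        fun w => (rangeCount ⌊α * (N : ℝ)⌋ w : ℝ) / (N : ℝ))
      atTop (𝓝 (-(1 - α) * Real.log (1 - α) - α * Real.log α)) := by
  have hm : Tendsto (fun N : ℕ => ((⌊α * (N : ℝ)⌋₊ : ℕ) : ℝ) / N) atTop (𝓝 α) :=
    (tendsto_nat_floor_mul_div_atTop hα0.le).comp (tendsto_natCast_atTop_atTop (R := ℝ))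
  have hle : ∀ N : ℕ, ⌊α * (N : ℝ)⌋₊ ≤ N := fun N => by
    apply Nat.floor_le_of_le
    nlinarith [(Nat.cast_nonneg N : (0 : ℝ) ≤ N)]
  have hk : Tendsto (fun N : ℕ => ((N - ⌊α * (N : ℝ)⌋₊ : ℕ) : ℝ) / N) atTop (𝓝 (1 - α)) := by
    refine (tendsto_const_nhds.sub hm).congr' ?_
    filter_upwards [eventually_gt_atTop 0] with N hN
    rw [Nat.cast_sub (hle N)]
    field_simp
  have t1 := hk.mul (harm_diff _ _ (by linarith) hk)
  have t2 := hm.mul (harm_diff _ _ hα0 hm)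
  have t3 := (t1.add t2).add (tendsto_one_div_atTop_nhds_zero_nat (𝕜 := ℝ))
  have e : -(1 - α) * Real.log (1 - α) - α * Real.log α =
      (1 - α) * -Real.log (1 - α) + α * -Real.log α + 0 := by ring
  rw [e]
  refine t3.congr' ?_
  have hpos : ∀ᶠ N : ℕ in atTop, 1 ≤ α * (N : ℝ) :=
    ((tendsto_natCast_atTop_atTop (R := ℝ)).const_mul_atTop hα0).eventually_ge_atTop 1
  filter_upwards [hpos, eventually_gt_atTop 0] with N h1 hN
  rw [expect_eq, ← Int.natCast_floor_eq_floor (by positivity)]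
  have hmp : 0 < ⌊α * (N : ℝ)⌋₊ := Nat.floor_pos.2 h1
  have := hit_sum _ (N - ⌊α * (N : ℝ)⌋₊) hmp
  rw [Nat.add_sub_cancel' (hle N)] at this
  rw [this]
  field_simp
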